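/- (Schmerl's classification) A countably infinite strict partial order is ultrahomogeneous if and only if it is order-isomorphic to one of the following: the countable antichain A_ω (ℕ with the empty order relation); B_n for some 1 ≤ n < ω; B_ω; C_n for some 1 ≤ n < ω; C_ω; or a countable random poset. -/

import Mathlib

open Set

/-- `A ⊆ X` is a copy of `⟨X,r⟩`: the range of a self-embedding of the relation `r`,
i.e. `A` with the induced order is order-isomorphic to `⟨X,r⟩`. -/
def IsCopy {X : Type*} (r : X → X → Prop) (A : Set X) : Prop :=
  ∃ f : X → X, Function.Injective f ∧ Set.range f = A ∧ ∀ x y, r x y ↔ r (f x) (f y)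

/-- The family `P(X)` of copies of `⟨X,r⟩`. -/
def Copies {X : Type*} (r : X → X → Prop) : Set (Set X) :=
  {A | IsCopy r A}

/-- `C` is a maximal chain in the family `S`, ordered by inclusion. -/
def IsMaxChainIn {X : Type*} (S : Set (Set X)) (C : Set (Set X)) : Prop :=
  C ⊆ S ∧ IsChain (· ⊆ ·) C ∧
    ∀ C' : Set (Set X), C' ⊆ S → IsChain (· ⊆ ·) C' → C ⊆ C' → C' = C

/-- A linear order is complete iff every subset has a supremum and an infimum. -/
def CompleteLO (L : Type*) [LinearOrder L] : Prop :=
  ∀ S : Set L, (∃ a, IsLUB S a) ∧ (∃ b, IsGLB S b)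

/-- `L` embeds into the reals by a strictly increasing map. -/
def REmbeddable (L : Type*) [LinearOrder L] : Prop :=
  ∃ f : L → ℝ, StrictMono f

/-- `L` has a minimum `0_L` which is non-isolated. -/
def BotNonIsolated (L : Type*) [LinearOrder L] : Prop :=
  ∃ z : L, IsBot z ∧ ∀ x, z < x → ∃ y, z < y ∧ y < x

/-- `L` has dense jumps. -/
def DenseJumps (L : Type*) [LinearOrder L] : Prop :=
  ∀ x y : L, x < y → ∃ a b : L, x ≤ a ∧ a < b ∧ b ≤ y ∧ ∀ c, ¬ (a < c ∧ c < b)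

/-- A linear order is Boolean iff it is complete and has dense jumps. -/
def BooleanLO (L : Type*) [LinearOrder L] : Prop :=
  CompleteLO L ∧ DenseJumps L

/-- Every isomorphism between finite suborders of `⟨X,r⟩` extends to an automorphism
of `⟨X,r⟩`. -/
def UltrahomogeneousRel {X : Type*} (r : X → X → Prop) : Prop :=
  ∀ (A : Set X) (f : X → X), A.Finite → Set.InjOn f A →
    (∀ x ∈ A, ∀ y ∈ A, (r x y ↔ r (f x) (f y))) →
    ∃ g : X ≃ X, (∀ x y, r x y ↔ r (g x) (g y)) ∧ ∀ x ∈ A, g x = f x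

/-- `⟨D,r⟩` is a strict partial order with the extension property defining the
countable random poset. -/
def IsRandomPosetRel {D : Type*} (r : D → D → Prop) : Prop :=
  (∀ x, ¬ r x x) ∧ (∀ x y z, r x y → r y z → r x z) ∧
    ∀ L G U : Finset D, Disjoint L G → Disjoint L U → Disjoint G U →
      (∀ l ∈ L, ∀ g ∈ G, r l g) →
      (∀ u ∈ U, ∀ l ∈ L, ¬ r u l) →
      (∀ u ∈ U, ∀ g ∈ G, ¬ r g u) →
      ∃ p : D, p ∉ L ∧ p ∉ G ∧ p ∉ U ∧ (∀ l ∈ L, r l p) ∧ (∀ g ∈ G, r p g) ∧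
        ∀ u ∈ U, p ≠ u ∧ ¬ r p u ∧ ¬ r u p

/-- A positive family of subsets of `D`. -/
def IsPositiveFamily {D : Type*} (P : Set (Set D)) : Prop :=
  ∅ ∉ P ∧ (∀ A B : Set D, A ∈ P → A ⊆ B → B ∈ P) ∧
    (∀ A ∈ P, ∀ F : Set D, F.Finite → A \ F ∈ P) ∧
    ∃ A ∈ P, Aᶜ.Infinite

/-- Isomorphism of binary relational structures. -/
def RelIsoRel {X Y : Type*} (r : X → X → Prop) (s : Y → Y → Prop) : Prop :=
  ∃ e : X ≃ Y, ∀ x y, r x y ↔ s (e x) (e y)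

/-- The strict partial order `B_I` on `I × ℚ`. -/
def BOrd (I : Type) : I × ℚ → I × ℚ → Prop := fun a b => a.1 = b.1 ∧ a.2 < b.2

/-- The strict partial order `C_I` on `ℚ × I`. -/
def COrd (I : Type) : ℚ × I → ℚ × I → Prop := fun a b => a.1 < b.1

/-- A set of pairs is a partial isomorphism. -/
def GoodRel {X : Type*} (r : X → X → Prop) (S : Set (X × X)) : Prop :=
  ∀ p ∈ S, ∀ q ∈ S, (p.1 = q.1 ↔ p.2 = q.2) ∧ (r p.1 q.1 ↔ r p.2 q.2)

lemma goodRel_swap {X : Type*} [DecidableEq X] {r : X → X → Prop} {S : Finset (X × X)}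
    (h : GoodRel r (S : Set (X × X))) :
    GoodRel r ((S.image Prod.swap : Finset (X × X)) : Set (X × X)) := by
  intro p hp q hq
  simp only [Finset.coe_image, Set.mem_image] at hp hq
  obtain ⟨p, hp, rfl⟩ := hp
  obtain ⟨q, hq, rfl⟩ := hq
  have := h p hp q hq
  exact ⟨this.1.symm, this.2.symm⟩

lemma goodRel_insert {X : Type*} [DecidableEq X] {r : X → X → Prop} (hirr : ∀ x, ¬ r x x)
    {S : Finset (X × X)} {x y : X}
    (h : GoodRel r (S : Set (X × X)))
    (hxy : ∀ p ∈ S, (p.1 = x ↔ p.2 = y) ∧ (r p.1 x ↔ r p.2 y) ∧ (r x p.1 ↔ r y p.2)) :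
    GoodRel r ((insert (x, y) S : Finset (X × X)) : Set (X × X)) := by
  intro p hp q hq
  simp only [Finset.coe_insert, Set.mem_insert_iff, Finset.mem_coe] at hp hq
  rcases hp with rfl | hp <;> rcases hq with rfl | hq
  · simp [hirr]
  · have := hxy q hq
    exact ⟨by rw [eq_comm, this.1, eq_comm], this.2.2⟩
  · have := hxy p hp
    exact ⟨this.1, this.2.1⟩
  · exact h p hp q hq

/-- Back and forth. -/
lemma ultra_of_ext {X : Type*} [Countable X] (r : X → X → Prop) (hirr : ∀ x, ¬ r x x)
    (hext : ∀ S : Finset (X × X), GoodRel r (S : Set (X × X)) → ∀ x, (∀ p ∈ S, p.1 ≠ x) →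
      ∃ y, ∀ p ∈ S, p.2 ≠ y ∧ (r p.1 x ↔ r p.2 y) ∧ (r x p.1 ↔ r y p.2)) :
    UltrahomogeneousRel r := by
  classical
  have hext' : ∀ S : Finset (X × X), GoodRel r (S : Set (X × X)) → ∀ x,
      ∃ y, GoodRel r ((insert (x, y) S : Finset (X × X)) : Set (X × X)) := by
    intro S hS x
    by_cases hx : ∃ p ∈ S, p.1 = x
    · obtain ⟨p, hp, rfl⟩ := hx
      refine ⟨p.2, ?_⟩
      rw [Finset.insert_eq_of_mem (by simpa using hp)]
      exact hS
    · push Not at hx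
      obtain ⟨y, hy⟩ := hext S hS x hx
      refine ⟨y, goodRel_insert hirr hS fun p hp => ⟨?_, (hy p hp).2⟩⟩
      simp [hx p hp, (hy p hp).1]
  have hext2 : ∀ S : Finset (X × X), GoodRel r (S : Set (X × X)) → ∀ y,
      ∃ x, GoodRel r ((insert (x, y) S : Finset (X × X)) : Set (X × X)) := by
    intro S hS y
    obtain ⟨x, hx⟩ := hext' _ (goodRel_swap hS) y
    refine ⟨x, ?_⟩
    have := goodRel_swap hx
    rw [Finset.image_insert, Finset.image_image] at this
    simpa using this
  intro A f hA hinj hf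
  let P := {S : Finset (X × X) // GoodRel r (S : Set (X × X))}
  let S0 : P := ⟨hA.toFinset.image fun a => (a, f a), by
    intro p hp q hq
    simp only [Finset.coe_image, Set.mem_image, Set.Finite.coe_toFinset] at hp hq
    obtain ⟨a, ha, rfl⟩ := hp
    obtain ⟨b, hb, rfl⟩ := hq
    exact ⟨(hinj.eq_iff ha hb).symm, hf a ha b hb⟩⟩
  let cof : X ⊕ X → Order.Cofinal P := fun z => match z with
    | Sum.inl x => ⟨{S | ∃ y, (x, y) ∈ S.1}, by
        intro S
        obtain ⟨y, hy⟩ := hext' S.1 S.2 x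
        exact ⟨⟨_, hy⟩, ⟨y, Finset.mem_insert_self _ _⟩, Finset.subset_insert _ _⟩⟩
    | Sum.inr y => ⟨{S | ∃ x, (x, y) ∈ S.1}, by
        intro S
        obtain ⟨x, hx⟩ := hext2 S.1 S.2 y
        exact ⟨⟨_, hx⟩, ⟨x, Finset.mem_insert_self _ _⟩, Finset.subset_insert _ _⟩⟩
  have : Encodable (X ⊕ X) := Encodable.ofCountable _
  let I : Order.Ideal P := Order.idealOfCofinals S0 cof
  have hF : ∀ x, ∃ y, ∃ S ∈ I, (x, y) ∈ S.1 := by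
    intro x
    obtain ⟨S, ⟨y, hy⟩, hS⟩ := Order.cofinal_meets_idealOfCofinals S0 cof (Sum.inl x)
    exact ⟨y, S, hS, hy⟩
  have hG : ∀ y, ∃ x, ∃ S ∈ I, (x, y) ∈ S.1 := by
    intro y
    obtain ⟨S, ⟨x, hx⟩, hS⟩ := Order.cofinal_meets_idealOfCofinals S0 cof (Sum.inr y)
    exact ⟨x, S, hS, hx⟩
  have key : ∀ p q : X × X, (∃ S ∈ I, p ∈ S.1) → (∃ S ∈ I, q ∈ S.1) →
      (p.1 = q.1 ↔ p.2 = q.2) ∧ (r p.1 q.1 ↔ r p.2 q.2) := by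
    rintro p q ⟨S, hS, hp⟩ ⟨T, hT, hq⟩
    obtain ⟨R, hR, h1, h2⟩ := I.directed S hS T hT
    exact R.2 p (h1 hp) q (h2 hq)
  choose F hF using hF
  choose G hG using hG
  refine ⟨⟨F, G, fun x => ?_, fun y => ?_⟩, fun x y => ?_, fun x hx => ?_⟩
  · exact ((key _ _ (hG (F x)) (hF x)).1.2 rfl)
  · exact ((key _ _ (hG y) (hF (G y))).1.1 rfl).symm
  · exact (key _ _ (hF x) (hF y)).2
  · have h0 : ∃ S ∈ I, (x, f x) ∈ S.1 := by
      refine ⟨S0, Order.mem_idealOfCofinals S0 cof, ?_⟩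
      simp only [S0, Finset.mem_image, Set.Finite.mem_toFinset]
      exact ⟨x, hx, rfl⟩
    exact (key _ _ (hF x) h0).1.1 rfl

lemma ultra_rat : UltrahomogeneousRel (fun a b : ℚ => a < b) := by
  classical
  apply ultra_of_ext _ (fun x => lt_irrefl x)
  intro S hS x hx
  obtain ⟨y, h1, h2⟩ := Order.exists_between_finsets
    (lo := (S.filter fun p => p.1 < x).image Prod.snd)
    (hi := (S.filter fun p => x < p.1).image Prod.snd) (by
      intro a ha b hb
      simp only [Finset.mem_image, Finset.mem_filter] at ha hb
      obtain ⟨p, ⟨hp, hpx⟩, rfl⟩ := ha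
      obtain ⟨q, ⟨hq, hqx⟩, rfl⟩ := hb
      exact (hS p hp q hq).2.1 (hpx.trans hqx))
  refine ⟨y, fun p hp => ?_⟩
  rcases lt_or_gt_of_ne (hx p hp) with h | h
  · have := h1 p.2 (Finset.mem_image.2 ⟨p, by simp [hp, h], rfl⟩)
    refine ⟨this.ne, iff_of_true h this, iff_of_false h.not_gt this.not_gt⟩
  · have := h2 p.2 (Finset.mem_image.2 ⟨p, by simp [hp, h], rfl⟩)
    refine ⟨this.ne', iff_of_false h.not_gt this.not_gt, iff_of_true h this⟩

lemma ultra_random {X : Type*} [Countable X] (r : X → X → Prop) (h : IsRandomPosetRel r) :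
    UltrahomogeneousRel r := by
  classical
  obtain ⟨hirr, htr, hE⟩ := h
  apply ultra_of_ext _ hirr
  intro S hS x hx
  obtain ⟨y, hL', hG', hU', hL, hG, hU⟩ := hE
    ((S.filter fun p => r p.1 x).image Prod.snd)
    ((S.filter fun p => r x p.1).image Prod.snd)
    ((S.filter fun p => ¬ r p.1 x ∧ ¬ r x p.1).image Prod.snd)
    (by
      rw [Finset.disjoint_left]
      intro a ha hb
      simp only [Finset.mem_image, Finset.mem_filter] at ha hb
      obtain ⟨p, ⟨hp, hpx⟩, rfl⟩ := ha
      obtain ⟨q, ⟨hq, hqx⟩, hpq⟩ := hb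
      have := (hS q hq p hp).1.2 hpq
      exact hirr x (htr _ _ _ (this ▸ hqx) hpx))
    (by
      rw [Finset.disjoint_left]
      intro a ha hb
      simp only [Finset.mem_image, Finset.mem_filter] at ha hb
      obtain ⟨p, ⟨hp, hpx⟩, rfl⟩ := ha
      obtain ⟨q, ⟨hq, hqx⟩, hpq⟩ := hb
      have := (hS q hq p hp).1.2 hpq
      exact hqx.1 (this ▸ hpx))
    (by
      rw [Finset.disjoint_left]
      intro a ha hb
      simp only [Finset.mem_image, Finset.mem_filter] at ha hb
      obtain ⟨p, ⟨hp, hpx⟩, rfl⟩ := ha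
      obtain ⟨q, ⟨hq, hqx⟩, hpq⟩ := hb
      have := (hS q hq p hp).1.2 hpq
      exact hqx.2 (this ▸ hpx))
    (by
      intro a ha b hb
      simp only [Finset.mem_image, Finset.mem_filter] at ha hb
      obtain ⟨p, ⟨hp, hpx⟩, rfl⟩ := ha
      obtain ⟨q, ⟨hq, hqx⟩, rfl⟩ := hb
      exact (hS p hp q hq).2.1 (htr _ _ _ hpx hqx))
    (by
      intro a ha b hb
      simp only [Finset.mem_image, Finset.mem_filter] at ha hb
      obtain ⟨p, ⟨hp, hpx⟩, rfl⟩ := ha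
      obtain ⟨q, ⟨hq, hqx⟩, rfl⟩ := hb
      exact fun h => hpx.1 (htr _ _ _ ((hS p hp q hq).2.2 h) hqx))
    (by
      intro a ha b hb
      simp only [Finset.mem_image, Finset.mem_filter] at ha hb
      obtain ⟨p, ⟨hp, hpx⟩, rfl⟩ := ha
      obtain ⟨q, ⟨hq, hqx⟩, rfl⟩ := hb
      exact fun h => hpx.2 (htr _ _ _ hqx ((hS q hq p hp).2.2 h)))
  have hasym : ∀ a b, r a b → ¬ r b a := fun a b h1 h2 => hirr a (htr _ _ _ h1 h2)
  refine ⟨y, fun p hp => ?_⟩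
  by_cases h1 : r p.1 x
  · have := hL p.2 (Finset.mem_image.2 ⟨p, by simp [hp, h1], rfl⟩)
    exact ⟨fun h => hirr y (h ▸ this), iff_of_true h1 this,
      iff_of_false (hasym _ _ h1) (hasym _ _ this)⟩
  · by_cases h2 : r x p.1
    · have := hG p.2 (Finset.mem_image.2 ⟨p, by simp [hp, h2], rfl⟩)
      exact ⟨fun h => hirr y (h ▸ this), iff_of_false (hasym _ _ h2) (hasym _ _ this),
        iff_of_true h2 this⟩
    · have := hU p.2 (Finset.mem_image.2 ⟨p, by simp [hp, h1, h2], rfl⟩)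
      exact ⟨this.1.symm, iff_of_false h1 this.2.2, iff_of_false h2 this.2.1⟩

lemma ultra_transfer {X Y : Type*} {r : X → X → Prop} {s : Y → Y → Prop}
    (h : RelIsoRel r s) (hs : UltrahomogeneousRel s) : UltrahomogeneousRel r := by
  obtain ⟨e, he⟩ := h
  intro A f hA hinj hf
  obtain ⟨g, hg, hgf⟩ := hs (e '' A) (fun y => e (f (e.symm y))) (hA.image _) (by
    rintro _ ⟨a, ha, rfl⟩ _ ⟨b, hb, rfl⟩ h
    simp only [Equiv.symm_apply_apply, EmbeddingLike.apply_eq_iff_eq] at h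
    rw [hinj ha hb h]) (by
    rintro _ ⟨a, ha, rfl⟩ _ ⟨b, hb, rfl⟩
    simp only [Equiv.symm_apply_apply]
    rw [← he, ← he]
    exact hf a ha b hb)
  refine ⟨(e.trans g).trans e.symm, fun x y => ?_, fun x hx => ?_⟩
  · simp only [Equiv.trans_apply]
    rw [he x y, hg, he]
    simp
  · have := hgf (e x) ⟨x, hx, rfl⟩
    simp [this]

/-- Finite partial injections extend to permutations. -/
lemma perm_extend {I : Type*} (A : Set I) (f : I → I) (hA : A.Finite) (hf : Set.InjOn f A) :
    ∃ g : I ≃ I, ∀ x ∈ A, g x = f x := by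
  have hemb : Function.Injective (fun a : A => f a) := fun a b h => Subtype.ext (hf a.2 b.2 h)
  cases finite_or_infinite I
  · obtain ⟨g, hg⟩ := Cardinal.extend_function_finite ⟨fun a : A => f a, hemb⟩ ⟨Equiv.refl I⟩
    exact ⟨g, fun x hx => hg ⟨x, hx⟩⟩
  · obtain ⟨g, hg⟩ := Cardinal.extend_function_of_lt ⟨fun a : A => f a, hemb⟩
      ((Cardinal.lt_aleph0_iff_set_finite.2 hA).trans_le (Cardinal.aleph0_le_mk I)) ⟨Equiv.refl I⟩
    exact ⟨g, fun x hx => hg ⟨x, hx⟩⟩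

lemma ultra_empty : UltrahomogeneousRel (fun _ _ : ℕ => False) := by
  intro A f hA hinj _
  obtain ⟨g, hg⟩ := perm_extend A f hA hinj
  exact ⟨g, fun _ _ => Iff.rfl, hg⟩

lemma ultra_B (I : Type) : UltrahomogeneousRel (BOrd I) := by
  classical
  intro A f hA hinj hf
  have hcl : ∀ x ∈ A, ∀ y ∈ A, (x.1 = y.1 ↔ (f x).1 = (f y).1) := by
    intro x hx y hy
    have h1 := hf x hx y hy
    have h2 := hf y hy x hx
    have h3 : x = y ↔ f x = f y := (hinj.eq_iff hx hy).symm
    simp only [BOrd, Prod.ext_iff] at h1 h2 h3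
    constructor
    · intro h
      rcases lt_trichotomy x.2 y.2 with h' | h' | h'
      · exact (h1.1 ⟨h, h'⟩).1
      · exact (h3.1 ⟨h, h'⟩).1
      · exact (h2.1 ⟨h.symm, h'⟩).1.symm
    · intro h
      rcases lt_trichotomy (f x).2 (f y).2 with h' | h' | h'
      · exact (h1.2 ⟨h, h'⟩).1
      · exact (h3.2 ⟨h, h'⟩).1
      · exact (h2.2 ⟨h.symm, h'⟩).1.symm
  -- the map on classes
  have hσ : ∃ σ0 : I → I, ∀ x ∈ A, σ0 x.1 = (f x).1 := by
    refine ⟨fun i => if h : ∃ x ∈ A, x.1 = i then (f h.choose).1 else i, fun x hx => ?_⟩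
    have h : ∃ y ∈ A, y.1 = x.1 := ⟨x, hx, rfl⟩
    simp only [dif_pos h]
    exact (hcl _ h.choose_spec.1 _ hx).1 h.choose_spec.2
  obtain ⟨σ0, hσ0⟩ := hσ
  obtain ⟨σ, hσ⟩ := perm_extend (Prod.fst '' A) σ0 (hA.image _) (by
    rintro _ ⟨x, hx, rfl⟩ _ ⟨y, hy, rfl⟩ h
    rw [hσ0 x hx, hσ0 y hy] at h
    exact (hcl x hx y hy).2 h)
  have hσA : ∀ x ∈ A, σ x.1 = (f x).1 := fun x hx => by rw [hσ _ ⟨x, hx, rfl⟩, hσ0 x hx]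
  have hτ : ∀ i : I, ∃ τ : ℚ ≃ ℚ, (∀ a b, a < b ↔ τ a < τ b) ∧
      ∀ q, (i, q) ∈ A → τ q = (f (i, q)).2 := by
    intro i
    have hfi : ∀ q q', (i, q) ∈ A → (i, q') ∈ A → (f (i, q)).1 = (f (i, q')).1 :=
      fun q q' h h' => (hcl _ h _ h').1 rfl
    exact ultra_rat {q | (i, q) ∈ A} (fun q => (f (i, q)).2)
      (hA.preimage (f := fun q : ℚ => (i, q)) (fun _ _ _ _ h => (Prod.ext_iff.1 h).2))
      (fun q hq q' hq' h => (Prod.ext_iff.1 (hinj hq hq' (Prod.ext (hfi q q' hq hq') h))).2)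
      (fun q hq q' hq' => by
        have := hf _ hq _ hq'
        simpa [BOrd, hfi q q' hq hq'] using this)
  choose τ hτ1 hτ2 using hτ
  refine ⟨⟨fun x => (σ x.1, τ x.1 x.2), fun y => (σ.symm y.1, (τ (σ.symm y.1)).symm y.2),
    fun x => by simp, fun x => by simp⟩, fun x y => ?_, fun x hx => ?_⟩
  · simp only [BOrd, Equiv.coe_fn_mk, EmbeddingLike.apply_eq_iff_eq]
    constructor
    · rintro ⟨h1, h2⟩
      exact ⟨h1, by rw [← h1]; exact (hτ1 _ _ _).1 h2⟩
    · rintro ⟨h1, h2⟩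
      exact ⟨h1, by rw [← h1] at h2; exact (hτ1 _ _ _).2 h2⟩
  · exact Prod.ext (hσA x hx) (hτ2 x.1 x.2 hx)

lemma ultra_C (I : Type) : UltrahomogeneousRel (COrd I) := by
  classical
  intro A f hA hinj hf
  have hcl : ∀ x ∈ A, ∀ y ∈ A, (x.1 = y.1 ↔ (f x).1 = (f y).1) := by
    intro x hx y hy
    have h1 := hf x hx y hy
    have h2 := hf y hy x hx
    simp only [COrd] at h1 h2
    rw [le_antisymm_iff, le_antisymm_iff, ← not_lt, ← not_lt, ← not_lt, ← not_lt, h1, h2]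
  have hσ : ∃ σ0 : ℚ → ℚ, ∀ x ∈ A, σ0 x.1 = (f x).1 := by
    refine ⟨fun i => if h : ∃ x ∈ A, x.1 = i then (f h.choose).1 else i, fun x hx => ?_⟩
    have h : ∃ y ∈ A, y.1 = x.1 := ⟨x, hx, rfl⟩
    simp only [dif_pos h]
    exact (hcl _ h.choose_spec.1 _ hx).1 h.choose_spec.2
  obtain ⟨σ0, hσ0⟩ := hσ
  obtain ⟨σ, hσl, hσ⟩ := ultra_rat (Prod.fst '' A) σ0 (hA.image _) (by
    rintro _ ⟨x, hx, rfl⟩ _ ⟨y, hy, rfl⟩ h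
    rw [hσ0 x hx, hσ0 y hy] at h
    exact (hcl x hx y hy).2 h) (by
    rintro _ ⟨x, hx, rfl⟩ _ ⟨y, hy, rfl⟩
    rw [hσ0 x hx, hσ0 y hy]
    exact hf x hx y hy)
  have hσA : ∀ x ∈ A, σ x.1 = (f x).1 := fun x hx => by rw [hσ _ ⟨x, hx, rfl⟩, hσ0 x hx]
  have hτ : ∀ q : ℚ, ∃ τ : I ≃ I, ∀ i, (q, i) ∈ A → τ i = (f (q, i)).2 := by
    intro q
    exact perm_extend {i | (q, i) ∈ A} (fun i => (f (q, i)).2)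
      (hA.preimage (f := fun i : I => (q, i)) (fun _ _ _ _ h => (Prod.ext_iff.1 h).2))
      (fun i hi j hj h => (Prod.ext_iff.1 (hinj hi hj
        (Prod.ext ((hcl _ hi _ hj).1 rfl) h))).2)
  choose τ hτ using hτ
  refine ⟨⟨fun x => (σ x.1, τ x.1 x.2), fun y => (σ.symm y.1, (τ (σ.symm y.1)).symm y.2),
    fun x => by simp, fun x => by simp⟩, fun x y => ?_, fun x hx => ?_⟩
  · exact hσl x.1 y.1
  · exact Prod.ext (hσA x hx) (hτ x.1 x.2 hx)

/-- Incomparable and distinct. -/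
def Inc {X : Type*} (r : X → X → Prop) (a b : X) : Prop := a ≠ b ∧ ¬ r a b ∧ ¬ r b a

/-- Automorphism. -/
def AutRel {X : Type*} (r : X → X → Prop) (g : X ≃ X) : Prop := ∀ x y, r x y ↔ r (g x) (g y)

lemma AutRel.inc {X : Type*} {r : X → X → Prop} {g : X ≃ X} (h : AutRel r g) (x y : X) :
    Inc r x y ↔ Inc r (g x) (g y) := by
  simp [Inc, ← h x y, ← h y x]

lemma Inc.symm {X : Type*} {r : X → X → Prop} {a b : X} (h : Inc r a b) : Inc r b a :=
  ⟨h.1.symm, h.2.2, h.2.1⟩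

lemma hom_good {X : Type*} {r : X → X → Prop} (hu : UltrahomogeneousRel r) (S : Set (X × X))
    (hfin : S.Finite) (hS : GoodRel r S) : ∃ g : X ≃ X, AutRel r g ∧ ∀ p ∈ S, g p.1 = p.2 := by
  classical
  have : ∃ f : X → X, ∀ p ∈ S, f p.1 = p.2 := by
    refine ⟨fun x => if h : ∃ p ∈ S, p.1 = x then h.choose.2 else x, fun p hp => ?_⟩
    have h : ∃ q ∈ S, q.1 = p.1 := ⟨p, hp, rfl⟩
    simp only [dif_pos h]
    exact (hS _ h.choose_spec.1 _ hp).1.1 h.choose_spec.2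
  obtain ⟨f, hf⟩ := this
  obtain ⟨g, hg, hgf⟩ := hu (Prod.fst '' S) f (hfin.image _) (by
    rintro _ ⟨p, hp, rfl⟩ _ ⟨q, hq, rfl⟩ h
    rw [hf p hp, hf q hq] at h
    exact (hS p hp q hq).1.2 h) (by
    rintro _ ⟨p, hp, rfl⟩ _ ⟨q, hq, rfl⟩
    rw [hf p hp, hf q hq]
    exact (hS p hp q hq).2)
  exact ⟨g, hg, fun p hp => by rw [hgf _ ⟨p, hp, rfl⟩, hf p hp]⟩

section
variable {X : Type*} {r : X → X → Prop}

lemma hom1 (hirr : ∀ x, ¬ r x x) (hu : UltrahomogeneousRel r) (a a' : X) :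
    ∃ g : X ≃ X, AutRel r g ∧ g a = a' := by
  obtain ⟨g, hg, h⟩ := hom_good hu {(a, a')} (by simp) (by
    intro p hp q hq
    simp only [Set.mem_singleton_iff] at hp hq
    subst hp; subst hq; simp [hirr])
  exact ⟨g, hg, h (a, a') (by simp)⟩

lemma hom2 (hirr : ∀ x, ¬ r x x) (hu : UltrahomogeneousRel r) {a b a' b' : X}
    (h0 : a ≠ b) (h0' : a' ≠ b') (h1 : r a b ↔ r a' b') (h2 : r b a ↔ r b' a') :
    ∃ g : X ≃ X, AutRel r g ∧ g a = a' ∧ g b = b' := by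
  obtain ⟨g, hg, h⟩ := hom_good hu {(a, a'), (b, b')} (by simp) (by
    intro p hp q hq
    simp only [Set.mem_insert_iff, Set.mem_singleton_iff] at hp hq
    rcases hp with rfl | rfl <;> rcases hq with rfl | rfl <;>
      simp [hirr, h0, h0', h0.symm, h0'.symm, h1, h2])
  exact ⟨g, hg, h (a, a') (by simp), h (b, b') (by simp)⟩

lemma hom3 (hirr : ∀ x, ¬ r x x) (hu : UltrahomogeneousRel r) {a b c a' b' c' : X}
    (h0 : a ≠ b) (h0' : a' ≠ b') (h1 : r a b ↔ r a' b') (h2 : r b a ↔ r b' a')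
    (k0 : a ≠ c) (k0' : a' ≠ c') (k1 : r a c ↔ r a' c') (k2 : r c a ↔ r c' a')
    (l0 : b ≠ c) (l0' : b' ≠ c') (l1 : r b c ↔ r b' c') (l2 : r c b ↔ r c' b') :
    ∃ g : X ≃ X, AutRel r g ∧ g a = a' ∧ g b = b' ∧ g c = c' := by
  obtain ⟨g, hg, h⟩ := hom_good hu {(a, a'), (b, b'), (c, c')} (by simp) (by
    intro p hp q hq
    simp only [Set.mem_insert_iff, Set.mem_singleton_iff] at hp hq
    rcases hp with rfl | rfl | rfl <;> rcases hq with rfl | rfl | rfl <;>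
      simp [hirr, h0, h0', h0.symm, h0'.symm, h1, h2, k0, k0', k0.symm, k0'.symm, k1, k2,
        l0, l0', l0.symm, l0'.symm, l1, l2])
  exact ⟨g, hg, h (a, a') (by simp), h (b, b') (by simp), h (c, c') (by simp)⟩

lemma hom2_lt (hirr : ∀ x, ¬ r x x) (htr : ∀ x y z, r x y → r y z → r x z)
    (hu : UltrahomogeneousRel r) {a b a' b' : X} (h : r a b) (h' : r a' b') :
    ∃ g : X ≃ X, AutRel r g ∧ g a = a' ∧ g b = b' := by
  apply hom2 hirr hu <;> grind

lemma hom2_inc (hirr : ∀ x, ¬ r x x)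
    (hu : UltrahomogeneousRel r) {a b a' b' : X} (h : Inc r a b) (h' : Inc r a' b') :
    ∃ g : X ≃ X, AutRel r g ∧ g a = a' ∧ g b = b' := by
  apply hom2 hirr hu <;> grind [Inc]

lemma hom3_inc (hirr : ∀ x, ¬ r x x)
    (hu : UltrahomogeneousRel r) {a b c a' b' c' : X} (h : Inc r a b) (h' : Inc r a' b')
    (k : Inc r a c) (k' : Inc r a' c') (l : Inc r b c) (l' : Inc r b' c') :
    ∃ g : X ≃ X, AutRel r g ∧ g a = a' ∧ g b = b' ∧ g c = c' := by
  apply hom3 hirr hu <;> grind [Inc]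

lemma ultra_flip (hu : UltrahomogeneousRel r) : UltrahomogeneousRel (fun a b => r b a) := by
  intro A f hA hinj hf
  obtain ⟨g, hg, hgf⟩ := hu A f hA hinj (fun x hx y hy => hf y hy x hx)
  exact ⟨g, fun x y => hg y x, hgf⟩

lemma inc_flip {a b : X} : Inc (fun a b => r b a) a b ↔ Inc r a b := by
  simp only [Inc]; tauto

/-- Every point has points above and below, density. -/
lemma basic_lt (hirr : ∀ x, ¬ r x x) (htr : ∀ x y z, r x y → r y z → r x z)
    (hu : UltrahomogeneousRel r) {x0 y0 : X} (h0 : r x0 y0) :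
    (∀ x, ∃ y, r x y) ∧ (∀ x, ∃ y, r y x) ∧ (∀ x y, r x y → ∃ z, r x z ∧ r z y) := by
  have h1 : ∀ x, ∃ y, r x y := fun x => by
    obtain ⟨g, hg, rfl⟩ := hom1 hirr hu x0 x
    exact ⟨g y0, (hg _ _).1 h0⟩
  have h2 : ∀ x, ∃ y, r y x := fun x => by
    obtain ⟨g, hg, rfl⟩ := hom1 hirr hu y0 x
    exact ⟨g x0, (hg _ _).1 h0⟩
  refine ⟨h1, h2, fun x y hxy => ?_⟩
  obtain ⟨z, hz⟩ := h1 y0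
  obtain ⟨g, hg, rfl, rfl⟩ := hom2_lt hirr htr hu (htr _ _ _ h0 hz) hxy
  exact ⟨g y0, (hg _ _).1 h0, (hg _ _).1 hz⟩

lemma P_all (hirr : ∀ x, ¬ r x x) (htr : ∀ x y z, r x y → r y z → r x z)
    (hu : UltrahomogeneousRel r) (hP : ∃ a b c, r a b ∧ Inc r c a ∧ Inc r c b) :
    (∀ a b, r a b → ∃ c, Inc r c a ∧ Inc r c b) ∧
    (∀ a c, Inc r a c → ∃ b, r a b ∧ Inc r c b) ∧
    (∀ b c, Inc r b c → ∃ a, r a b ∧ Inc r c a) := by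
  obtain ⟨a0, b0, c0, h1, h2, h3⟩ := hP
  refine ⟨fun a b h => ?_, fun a c h => ?_, fun b c h => ?_⟩
  · obtain ⟨g, hg, rfl, rfl⟩ := hom2_lt hirr htr hu h1 h
    exact ⟨g c0, (hg.inc _ _).1 h2, (hg.inc _ _).1 h3⟩
  · obtain ⟨g, hg, rfl, rfl⟩ := hom2_inc hirr hu h2.symm h
    exact ⟨g b0, (hg _ _).1 h1, (hg.inc _ _).1 h3⟩
  · obtain ⟨g, hg, rfl, rfl⟩ := hom2_inc hirr hu h3.symm h
    exact ⟨g a0, (hg _ _).1 h1, (hg.inc _ _).1 h2⟩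

lemma V_all (hirr : ∀ x, ¬ r x x) (htr : ∀ x y z, r x y → r y z → r x z)
    (hu : UltrahomogeneousRel r) (hV : ∃ a b c, r a b ∧ r a c ∧ Inc r b c) :
    (∀ a b, r a b → ∃ c, r a c ∧ Inc r b c) ∧
    (∀ b c, Inc r b c → ∃ a, r a b ∧ r a c) := by
  obtain ⟨a0, b0, c0, h1, h2, h3⟩ := hV
  refine ⟨fun a b h => ?_, fun b c h => ?_⟩
  · obtain ⟨g, hg, rfl, rfl⟩ := hom2_lt hirr htr hu h1 h
    exact ⟨g c0, (hg _ _).1 h2, (hg.inc _ _).1 h3⟩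
  · obtain ⟨g, hg, rfl, rfl⟩ := hom2_inc hirr hu h3 h
    exact ⟨g a0, (hg _ _).1 h1, (hg _ _).1 h2⟩

/-- P and V give the dual of V. -/
lemma Lam_of_V (hirr : ∀ x, ¬ r x x) (htr : ∀ x y z, r x y → r y z → r x z)
    (hu : UltrahomogeneousRel r) (hP : ∃ a b c, r a b ∧ Inc r c a ∧ Inc r c b)
    (hV : ∃ a b c, r a b ∧ r a c ∧ Inc r b c) :
    ∃ a b c, r b a ∧ r c a ∧ Inc r b c := by
  by_contra hno
  have hno' : ∀ a b c, r b a → r c a → ¬ Inc r b c := fun a b c h1 h2 h3 =>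
    hno ⟨a, b, c, h1, h2, h3⟩
  obtain ⟨a, b0, c, h1, h2, h3⟩ := hP
  obtain ⟨a0, x0, y0, k1, k2, k3⟩ := hV
  obtain ⟨g, hg, rfl⟩ := hom1 hirr hu a0 a
  rw [hg] at k1 k2
  rw [hg.inc] at k3
  generalize g a0 = a at *
  generalize g x0 = b1 at *
  generalize g y0 = b2 at *
  have hc1 : Inc r c b1 := by
    have := hno' b1 c a
    grind [Inc]
  have hc2 : Inc r c b2 := by
    have := hno' b2 c a
    grind [Inc]
  obtain ⟨τ, hτ, e1, e2, e3⟩ := hom3_inc hirr hu hc1 hc1.symm hc2 k3 k3 hc2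
  have t1 : r (τ a) c := by rw [← e2, ← hτ]; exact k1
  have t2 : r (τ a) b2 := by conv_rhs => rw [← e3]
                             rw [← hτ]; exact k2
  have t3 : ¬ r (τ a) b1 := by rw [← e1, ← hτ]; exact h2.2.2
  have := hno' b2 a (τ a) k2 t2
  grind [Inc]

/-- The omnibus: two-point case of T1. -/
lemma T1_two (hirr : ∀ x, ¬ r x x) (htr : ∀ x y z, r x y → r y z → r x z)
    (hu : UltrahomogeneousRel r) (hP : ∃ a b c, r a b ∧ Inc r c a ∧ Inc r c b)
    (hV : ∃ a b c, r a b ∧ r a c ∧ Inc r b c)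
    (hL : ∃ a b c, r b a ∧ r c a ∧ Inc r b c) :
    ∃ l l' v p, r l p ∧ r l' p ∧ Inc r l l' ∧ Inc r v l ∧ Inc r v l' ∧ Inc r v p := by
  obtain ⟨p, l, l', h1, h2, h3⟩ := hL
  obtain ⟨w, hw, hw'⟩ := (V_all hirr htr hu hV).2 l l' h3
  obtain ⟨v, hv, hv'⟩ := (P_all hirr htr hu hP).1 w p (htr _ _ _ hw h1)
  exact ⟨l, l', v, p, h1, h2, h3, by grind [Inc], by grind [Inc], hv'⟩

lemma T1_A3 (hirr : ∀ x, ¬ r x x) (htr : ∀ x y z, r x y → r y z → r x z)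
    (hu : UltrahomogeneousRel r) (hP : ∃ a b c, r a b ∧ Inc r c a ∧ Inc r c b)
    (hV : ∃ a b c, r a b ∧ r a c ∧ Inc r b c)
    (hL : ∃ a b c, r b a ∧ r c a ∧ Inc r b c) {a b u : X}
    (hab : Inc r a b) (hau : Inc r a u) (hbu : Inc r b u) :
    ∃ q, r a q ∧ r b q ∧ Inc r u q := by
  obtain ⟨l, l', v, p, h1, h2, h3, h4, h5, h6⟩ := T1_two hirr htr hu hP hV hL
  obtain ⟨g, hg, rfl, rfl, rfl⟩ := hom3_inc hirr hu h3 hab h4.symm hau h5.symm hbu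
  exact ⟨g p, (hg _ _).1 h1, (hg _ _).1 h2, (hg.inc _ _).1 h6⟩

lemma T1_N (hirr : ∀ x, ¬ r x x) (htr : ∀ x y z, r x y → r y z → r x z)
    (hu : UltrahomogeneousRel r) (hP : ∃ a b c, r a b ∧ Inc r c a ∧ Inc r c b)
    (hV : ∃ a b c, r a b ∧ r a c ∧ Inc r b c)
    (hL : ∃ a b c, r b a ∧ r c a ∧ Inc r b c) {a b u : X}
    (hab : Inc r a b) (hau : r a u) (hbu : Inc r b u) :
    ∃ q, r a q ∧ r b q ∧ Inc r u q := by
  obtain ⟨l, l', v, p, h1, h2, h3, h4, h5, h6⟩ := T1_two hirr htr hu hP hV hL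
  obtain ⟨p', k1, k2, k3⟩ := T1_A3 hirr htr hu hP hV hL h4.symm h3 h5
  have hpp : Inc r p' p := by grind [Inc]
  obtain ⟨g, hg, rfl, rfl, rfl⟩ : ∃ g : X ≃ X, AutRel r g ∧ g l = a ∧ g l' = b ∧ g p' = u := by
    apply hom3 hirr hu <;> grind [Inc]
  exact ⟨g p, (hg _ _).1 h1, (hg _ _).1 h2, (hg.inc _ _).1 hpp⟩

lemma T1_dir (hirr : ∀ x, ¬ r x x) (htr : ∀ x y z, r x y → r y z → r x z)
    (hu : UltrahomogeneousRel r) (hP : ∃ a b c, r a b ∧ Inc r c a ∧ Inc r c b)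
    (hV : ∃ a b c, r a b ∧ r a c ∧ Inc r b c)
    (hL : ∃ a b c, r b a ∧ r c a ∧ Inc r b c)
    (T3 : ∀ L G : Finset X, (∀ l ∈ L, ∀ g ∈ G, r l g) → ∃ p, (∀ l ∈ L, r l p) ∧ ∀ g ∈ G, r p g)
    {a b u : X} (ha : ¬ r u a) (ha' : u ≠ a) (hb : ¬ r u b) (hb' : u ≠ b) :
    ∃ q, r a q ∧ r b q ∧ ¬ r u q ∧ u ≠ q := by
  classical
  have one : ∀ b, ¬ r u b → u ≠ b → ∃ q, r b q ∧ ¬ r u q ∧ u ≠ q := by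
    intro b hb hb'
    by_cases h : r b u
    · obtain ⟨p, h1, h2⟩ := T3 {b} {u} (by simpa using h)
      simp only [Finset.mem_singleton, forall_eq] at h1 h2
      exact ⟨p, h1, by grind, by grind⟩
    · obtain ⟨q, h1, h2⟩ := (P_all hirr htr hu hP).2.1 b u ⟨hb'.symm, h, hb⟩
      exact ⟨q, h1, by grind [Inc], by grind [Inc]⟩
  by_cases hab : a = b
  · subst hab
    obtain ⟨q, hq⟩ := one a ha ha'
    exact ⟨q, hq.1, hq⟩
  by_cases hab1 : r a b
  · obtain ⟨q, hq⟩ := one b hb hb'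
    exact ⟨q, htr _ _ _ hab1 hq.1, hq⟩
  by_cases hab2 : r b a
  · obtain ⟨q, hq⟩ := one a ha ha'
    exact ⟨q, hq.1, htr _ _ _ hab2 hq.1, hq.2⟩
  have hI : Inc r a b := ⟨hab, hab1, hab2⟩
  by_cases hau : r a u <;> by_cases hbu : r b u
  · obtain ⟨p, h1, h2⟩ := T3 {a, b} {u} (by simp [hau, hbu])
    simp only [Finset.mem_singleton, forall_eq, Finset.mem_insert, forall_eq_or_imp] at h1 h2
    exact ⟨p, h1.1, h1.2, by grind, by grind⟩
  · obtain ⟨q, h1, h2, h3⟩ := T1_N hirr htr hu hP hV hL hI hau ⟨hb'.symm, hbu, hb⟩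
    exact ⟨q, h1, h2, h3.2.1, h3.1⟩
  · obtain ⟨q, h1, h2, h3⟩ := T1_N hirr htr hu hP hV hL hI.symm hbu ⟨ha'.symm, hau, ha⟩
    exact ⟨q, h2, h1, h3.2.1, h3.1⟩
  · obtain ⟨q, h1, h2, h3⟩ := T1_A3 hirr htr hu hP hV hL hI ⟨ha'.symm, hau, ha⟩
      ⟨hb'.symm, hbu, hb⟩
    exact ⟨q, h1, h2, h3.2.1, h3.1⟩

/-- Every finite set has a strict upper bound. -/
lemma ub_all (hirr : ∀ x, ¬ r x x) (htr : ∀ x y z, r x y → r y z → r x z)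
    (hu : UltrahomogeneousRel r) [Nonempty X]
    (hL : ∃ a b c, r b a ∧ r c a ∧ Inc r b c) (S : Finset X) : ∃ p, ∀ l ∈ S, r l p := by
  classical
  induction S using Finset.induction_on with
  | empty => exact ⟨Classical.arbitrary X, by simp⟩
  | insert x S hx ih =>
    obtain ⟨p, hp⟩ := ih
    obtain ⟨a0, b0, c0, k1, k2, k3⟩ := hL
    have hup := (basic_lt hirr htr hu k1).1
    have : ∃ q, r x q ∧ r p q := by
      by_cases h1 : r x p
      · obtain ⟨q, hq⟩ := hup p
        exact ⟨q, htr _ _ _ h1 hq, hq⟩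
      by_cases h2 : r p x
      · obtain ⟨q, hq⟩ := hup x
        exact ⟨q, hq, htr _ _ _ h2 hq⟩
      by_cases h3 : x = p
      · obtain ⟨q, hq⟩ := hup x
        exact ⟨q, hq, h3 ▸ hq⟩
      obtain ⟨g, hg, rfl, rfl⟩ := hom2_inc hirr hu k3 ⟨h3, h1, h2⟩
      exact ⟨g a0, (hg _ _).1 k1, (hg _ _).1 k2⟩
    obtain ⟨q, h1, h2⟩ := this
    refine ⟨q, fun l hl => ?_⟩
    rcases Finset.mem_insert.1 hl with rfl | hl
    · exact h1
    · exact htr _ _ _ (hp l hl) h2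

/-- Interpolation. -/
lemma T3_all (hirr : ∀ x, ¬ r x x) (htr : ∀ x y z, r x y → r y z → r x z)
    (hu : UltrahomogeneousRel r) [Nonempty X]
    (hV : ∃ a b c, r a b ∧ r a c ∧ Inc r b c)
    (hL : ∃ a b c, r b a ∧ r c a ∧ Inc r b c)
    (L G : Finset X) (hLG : ∀ l ∈ L, ∀ g ∈ G, r l g) :
    ∃ p, (∀ l ∈ L, r l p) ∧ ∀ g ∈ G, r p g := by
  obtain ⟨p0, hp0⟩ := ub_all hirr htr hu hL L
  obtain ⟨q0, hq0⟩ := ub_all (r := fun a b => r b a) hirr (fun x y z h1 h2 => htr _ _ _ h2 h1)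
    (ultra_flip hu) (by
      obtain ⟨a, b, c, h1, h2, h3⟩ := hV
      exact ⟨a, b, c, h1, h2, inc_flip.2 h3⟩) G
  obtain ⟨σ, hσ, rfl⟩ := hom1 hirr hu q0 p0
  have hasym : ∀ a b, r a b → ¬ r b a := fun a b h1 h2 => hirr a (htr _ _ _ h1 h2)
  have hcross : ∀ l ∈ L, ∀ g ∈ G, r l (σ g) := fun l hl g hg =>
    htr _ _ _ (hp0 l hl) ((hσ _ _).1 (hq0 g hg))
  obtain ⟨τ, hτ, h⟩ := hom_good hu (((fun x => (x, x)) '' (L : Set X)) ∪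
    ((fun x => (x, σ x)) '' (G : Set X)))
    ((L.finite_toSet.image _).union (G.finite_toSet.image _)) (by
      have hne : ∀ a b, r a b → a ≠ b := fun a b h h' => hirr a (by rw [← h'] at h; exact h)
      rintro _ (⟨a, ha, rfl⟩ | ⟨a, ha, rfl⟩) _ (⟨b, hb, rfl⟩ | ⟨b, hb, rfl⟩)
      · simp
      · have h1 := hLG a ha b hb
        have h2 := hcross a ha b hb
        exact ⟨iff_of_false (hne _ _ h1) (hne _ _ h2), iff_of_true h1 h2⟩
      · have h1 := hLG b hb a ha
        have h2 := hcross b hb a ha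
        exact ⟨iff_of_false (hne _ _ h1).symm (hne _ _ h2).symm,
          iff_of_false (hasym _ _ h1) (hasym _ _ h2)⟩
      · exact ⟨by simp, hσ a b⟩)
  refine ⟨τ.symm (σ q0), fun l hl => ?_, fun g hg => ?_⟩
  · rw [hτ, Equiv.apply_symm_apply, show τ l = l from h (l, l) (Or.inl ⟨l, hl, rfl⟩)]
    exact hp0 l hl
  · rw [hτ, Equiv.apply_symm_apply, show τ g = σ g from h (g, σ g) (Or.inr ⟨g, hg, rfl⟩)]
    exact (hσ _ _).1 (hq0 g hg)

/-- `L < p < G` and `p` not above-or-equal any `u ∈ U`. -/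
lemma T1_all (hirr : ∀ x, ¬ r x x) (htr : ∀ x y z, r x y → r y z → r x z)
    (hu : UltrahomogeneousRel r) [Nonempty X]
    (hP : ∃ a b c, r a b ∧ Inc r c a ∧ Inc r c b)
    (hV : ∃ a b c, r a b ∧ r a c ∧ Inc r b c)
    (hL : ∃ a b c, r b a ∧ r c a ∧ Inc r b c)
    (L G U : Finset X) (hLG : ∀ l ∈ L, ∀ g ∈ G, r l g)
    (hUL : ∀ u ∈ U, ∀ l ∈ L, ¬ r u l ∧ u ≠ l) :
    ∃ p, (∀ l ∈ L, r l p) ∧ (∀ g ∈ G, r p g) ∧ ∀ u ∈ U, ¬ r u p ∧ u ≠ p := by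
  classical
  have T3 := T3_all hirr htr hu hV hL
  have single : ∀ u : X, ∀ L : Finset X, (∀ l ∈ L, ¬ r u l ∧ u ≠ l) →
      ∃ p, (∀ l ∈ L, r l p) ∧ ¬ r u p ∧ u ≠ p := by
    intro u L
    induction L using Finset.induction_on with
    | empty =>
      intro _
      obtain ⟨a, b, c, h1, -⟩ := hP
      obtain ⟨p, hp⟩ := (basic_lt hirr htr hu h1).2.1 u
      exact ⟨p, by simp, by grind, by grind⟩
    | insert x S hx ih =>
      intro h
      obtain ⟨p, hp, hp1, hp2⟩ := ih fun l hl => h l (Finset.mem_insert_of_mem hl)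
      have hx := h x (Finset.mem_insert_self _ _)
      obtain ⟨q, h1, h2, h3⟩ := T1_dir hirr htr hu hP hV hL T3 hx.1 hx.2 hp1 hp2
      refine ⟨q, fun l hl => ?_, h3⟩
      rcases Finset.mem_insert.1 hl with rfl | hl
      · exact h1
      · exact htr _ _ _ (hp l hl) h2
  have : ∀ u : X, ∃ p, u ∈ U → ((∀ l ∈ L, r l p) ∧ ¬ r u p ∧ u ≠ p) := by
    intro u
    by_cases h : u ∈ U
    · obtain ⟨p, hp⟩ := single u L (hUL u h)
      exact ⟨p, fun _ => hp⟩
    · exact ⟨u, fun h' => absurd h' h⟩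
  choose P hPu using this
  obtain ⟨p, h1, h2⟩ := T3 L (G ∪ U.image P) (by
    intro l hl g hg
    rcases Finset.mem_union.1 hg with hg | hg
    · exact hLG l hl g hg
    · obtain ⟨u, hu, rfl⟩ := Finset.mem_image.1 hg
      exact (hPu u hu).1 l hl)
  refine ⟨p, h1, fun g hg => h2 g (Finset.mem_union_left _ hg), fun u hu => ?_⟩
  have := h2 (P u) (Finset.mem_union_right _ (Finset.mem_image_of_mem _ hu))
  have h3 := hPu u hu
  exact ⟨fun h => h3.2.1 (htr _ _ _ h this), fun h => h3.2.1 (h ▸ this)⟩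

lemma random_of (hirr : ∀ x, ¬ r x x) (htr : ∀ x y z, r x y → r y z → r x z)
    (hu : UltrahomogeneousRel r) [Nonempty X]
    (hP : ∃ a b c, r a b ∧ Inc r c a ∧ Inc r c b)
    (hV : ∃ a b c, r a b ∧ r a c ∧ Inc r b c)
    (hL : ∃ a b c, r b a ∧ r c a ∧ Inc r b c) : IsRandomPosetRel r := by
  classical
  refine ⟨hirr, htr, fun L G U dLG dLU dGU c1 c2 c3 => ?_⟩
  have hPf : ∃ a b c, r b a ∧ Inc (fun a b => r b a) c a ∧ Inc (fun a b => r b a) c b := by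
    obtain ⟨a, b, c, h1, h2, h3⟩ := hP
    exact ⟨b, a, c, h1, inc_flip.2 h3, inc_flip.2 h2⟩
  have hVf : ∃ a b c, r b a ∧ r c a ∧ Inc (fun a b => r b a) b c := by
    obtain ⟨a, b, c, h1, h2, h3⟩ := hL
    exact ⟨a, b, c, h1, h2, inc_flip.2 h3⟩
  have hLf : ∃ a b c, r a b ∧ r a c ∧ Inc (fun a b => r b a) b c := by
    obtain ⟨a, b, c, h1, h2, h3⟩ := hV
    exact ⟨a, b, c, h1, h2, inc_flip.2 h3⟩
  have htrf : ∀ x y z, r y x → r z y → r z x := fun x y z h1 h2 => htr _ _ _ h2 h1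
  obtain ⟨m, hm⟩ := ub_all (r := fun a b => r b a) hirr htrf (ultra_flip hu) hLf U
  have hw : ∀ u : X, ∃ w, u ∈ U → ((∀ g ∈ G, r w g) ∧ (¬ r w u ∧ u ≠ w) ∧
      ∀ u' ∈ U, ¬ r u' w ∧ u' ≠ w) := by
    intro u
    by_cases h : u ∈ U
    · obtain ⟨x, hx1, hx2⟩ := (P_all hirr htr hu hP).1 m u (hm u h)
      obtain ⟨w, k1, -, k3⟩ := T1_all (r := fun a b => r b a) hirr htrf (ultra_flip hu)
        hPf hVf hLf (insert x G) ∅ {u} (by simp) (by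
          intro u' hu' g hg
          obtain rfl := Finset.mem_singleton.1 hu'
          rcases Finset.mem_insert.1 hg with rfl | hg
          · exact ⟨hx2.2.1, hx2.1.symm⟩
          · exact ⟨c3 u' h g hg, fun e => Finset.disjoint_left.1 dGU hg (e ▸ h)⟩)
      have hwx : r w x := k1 x (Finset.mem_insert_self _ _)
      refine ⟨w, fun _ => ⟨fun g hg => k1 g (Finset.mem_insert_of_mem hg),
        k3 u (Finset.mem_singleton_self _), fun u' hu' => ?_⟩⟩
      have hmu := hm u' hu'
      exact ⟨fun e => hx1.2.2 (htr _ _ _ hmu (htr _ _ _ e hwx)),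
        fun e => hx1.2.2 (htr _ _ _ hmu (e ▸ hwx))⟩
    · exact ⟨u, fun h' => absurd h' h⟩
  choose W hW using hw
  obtain ⟨p, h1, h2, h3⟩ := T1_all hirr htr hu hP hV hL (L ∪ U.image W) G U (by
      intro l hl g hg
      rcases Finset.mem_union.1 hl with hl | hl
      · exact c1 l hl g hg
      · obtain ⟨u, hu, rfl⟩ := Finset.mem_image.1 hl
        exact (hW u hu).1 g hg) (by
      intro u hu l hl
      rcases Finset.mem_union.1 hl with hl | hl
      · exact ⟨c2 u hu l hl, fun e => Finset.disjoint_left.1 dLU hl (e ▸ hu)⟩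
      · obtain ⟨u', hu', rfl⟩ := Finset.mem_image.1 hl
        exact (hW u' hu').2.2 u hu)
  refine ⟨p, fun h => ?_, fun h => hirr _ (h2 p h), fun h => (h3 p h).2 rfl,
    fun l hl => h1 l (Finset.mem_union_left _ hl), h2, fun u hu => ⟨(h3 u hu).2.symm, ?_,
      (h3 u hu).1⟩⟩
  · exact hirr _ (h1 p (Finset.mem_union_left _ h))
  · intro e
    have := h1 (W u) (Finset.mem_union_right _ (Finset.mem_image_of_mem _ hu))
    exact (hW u hu).2.1.1 (htr _ _ _ this e)

end

lemma iso_rat {Y : Type*} [Countable Y] [Nonempty Y] (r : Y → Y → Prop) (hirr : ∀ x, ¬ r x x)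
    (htr : ∀ x y z, r x y → r y z → r x z) (htot : ∀ x y, r x y ∨ x = y ∨ r y x)
    (hup : ∀ x, ∃ y, r x y) (hdn : ∀ x, ∃ y, r y x)
    (hd : ∀ x y, r x y → ∃ z, r x z ∧ r z y) :
    ∃ e : Y ≃ ℚ, ∀ x y, r x y ↔ e x < e y := by
  classical
  letI : LinearOrder Y :=
    { le := fun a b => a = b ∨ r a b
      lt := r
      le_refl := fun a => Or.inl rfl
      le_trans := by grind
      le_antisymm := by grind
      lt_iff_le_not_ge := by grind
      le_total := by grind
      toDecidableLE := Classical.decRel _ }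
  haveI : DenselyOrdered Y := ⟨fun a b h => hd a b h⟩
  haveI : NoMaxOrder Y := ⟨fun a => hup a⟩
  haveI : NoMinOrder Y := ⟨fun a => hdn a⟩
  obtain ⟨e⟩ := Order.iso_of_countable_dense Y ℚ
  exact ⟨e.toEquiv, fun x y => (e.lt_iff_lt (x := x) (y := y)).symm⟩

lemma countable_cases (J : Type*) [Countable J] [Nonempty J] :
    (∃ n : ℕ, 1 ≤ n ∧ Nonempty (J ≃ Fin n)) ∨ Nonempty (J ≃ ℕ) := by
  cases finite_or_infinite J
  · left
    obtain ⟨n, ⟨e⟩⟩ := Finite.exists_equiv_fin J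
    refine ⟨n, ?_, ⟨e⟩⟩
    have := (e (Classical.arbitrary J)).2
    omega
  · right
    exact nonempty_equiv_of_countable

lemma case_B {X : Type*} [Countable X] [Nonempty X] {r : X → X → Prop}
    (hirr : ∀ x, ¬ r x x) (htr : ∀ x y z, r x y → r y z → r x z)
    (hup : ∀ x, ∃ y, r x y) (hdn : ∀ x, ∃ y, r y x)
    (hd : ∀ x y, r x y → ∃ z, r x z ∧ r z y)
    (hV : ∀ a b c, r a b → r a c → ¬ Inc r b c) (hL : ∀ a b c, r b a → r c a → ¬ Inc r b c) :
    (∃ n : ℕ, 1 ≤ n ∧ RelIsoRel r (BOrd (Fin n))) ∨ RelIsoRel r (BOrd ℕ) := by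
  let s : Setoid X := ⟨fun a b => ¬ Inc r a b, ⟨fun a => by simp [Inc],
    fun {a b} h h' => h h'.symm, fun {a b c} h1 h2 h3 => by
      have k1 := hV b a c
      have k2 := hL b a c
      clear hV hL hup hdn hd
      have t1 := htr a b c
      have t2 := htr c b a
      clear htr
      unfold Inc at *
      by_cases e1 : a = b
      · subst e1; exact h2 h3
      by_cases e2 : b = c
      · subst e2; exact h1 h3
      by_cases e3 : a = c
      · exact h3.1 e3
      tauto⟩⟩
  have hs : ∀ a b : X, (Quotient.mk s a = Quotient.mk s b) ↔ ¬ Inc r a b := fun a b => by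
    rw [Quotient.eq]; rfl
  have hrs : ∀ a b, r a b → Quotient.mk s a = Quotient.mk s b := fun a b h => by
    rw [hs]; exact fun h' => h'.2.1 h
  have hcls : ∀ q : Quotient s, ∃ e : {x : X // Quotient.mk s x = q} ≃ ℚ,
      ∀ x y, r x.1 y.1 ↔ e x < e y := by
    intro q
    haveI : Nonempty {x : X // Quotient.mk s x = q} := by
      obtain ⟨x, hx⟩ := Quotient.exists_rep q
      exact ⟨⟨x, hx⟩⟩
    refine iso_rat (fun x y : {x : X // Quotient.mk s x = q} => r x.1 y.1)
      (fun x => hirr _) (fun x y z => htr _ _ _) ?_ ?_ ?_ ?_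
    · rintro ⟨x, rfl⟩ ⟨y, hy⟩
      have := (hs y x).1 hy
      simp only [Subtype.mk.injEq]
      grind [Inc]
    · rintro ⟨x, rfl⟩
      obtain ⟨y, hy⟩ := hup x
      exact ⟨⟨y, (hrs _ _ hy).symm⟩, hy⟩
    · rintro ⟨x, rfl⟩
      obtain ⟨y, hy⟩ := hdn x
      exact ⟨⟨y, hrs _ _ hy⟩, hy⟩
    · rintro ⟨x, rfl⟩ ⟨y, hy⟩ h
      obtain ⟨z, hz⟩ := hd x y h
      exact ⟨⟨z, (hrs _ _ hz.1).symm⟩, hz⟩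
  choose e he using hcls
  have main : ∀ I : Type, Nonempty (Quotient s ≃ I) → RelIsoRel r (BOrd I) := by
    rintro I ⟨k⟩
    refine ⟨⟨fun x => (k (Quotient.mk s x), e _ ⟨x, rfl⟩), fun y => ((e (k.symm y.1)).symm y.2).1,
      fun x => ?_, fun y => ?_⟩, fun x y => ?_⟩
    · have : ∀ q (h : Quotient.mk s x = q), ((e q).symm (e _ ⟨x, rfl⟩)).1 = x := by
        rintro _ rfl
        simp
      exact this _ (by simp)
    · have key : ∀ q' (z : {x : X // Quotient.mk s x = q'}),
          ((k (Quotient.mk s z.1), e _ ⟨z.1, rfl⟩) : I × ℚ) = (k q', e q' z) := by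
        rintro _ ⟨z, rfl⟩; rfl
      exact (key _ ((e (k.symm y.1)).symm y.2)).trans (by simp)
    · simp only [BOrd, Equiv.coe_fn_mk, EmbeddingLike.apply_eq_iff_eq]
      have key : ∀ q (hx : Quotient.mk s x = q) (hy : Quotient.mk s y = q),
          (r x y ↔ e _ (⟨x, rfl⟩ : {z : X // Quotient.mk s z = Quotient.mk s x}) <
            e _ (⟨y, rfl⟩ : {z : X // Quotient.mk s z = Quotient.mk s y})) := by
        intro q hx hy
        subst hx
        rw [he _ ⟨x, rfl⟩ ⟨y, hy⟩]
        have : ∀ q (h : Quotient.mk s y = q), e q ⟨y, h⟩ = e _ ⟨y, rfl⟩ := by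
          rintro _ rfl; rfl
        rw [this]
      constructor
      · intro h
        exact ⟨hrs _ _ h, (key _ rfl (hrs _ _ h).symm).1 h⟩
      · rintro ⟨h1, h2⟩
        exact (key _ rfl h1.symm).2 h2
  have hne : Nonempty (Quotient s) := ⟨Quotient.mk s (Classical.arbitrary X)⟩
  rcases countable_cases (Quotient s) with ⟨n, hn, k⟩ | k
  · exact Or.inl ⟨n, hn, main _ k⟩
  · exact Or.inr (main _ k)

lemma case_C {X : Type*} [Countable X] [Nonempty X] {r : X → X → Prop}
    (hirr : ∀ x, ¬ r x x) (htr : ∀ x y z, r x y → r y z → r x z)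
    (hu : UltrahomogeneousRel r)
    (hup : ∀ x, ∃ y, r x y) (hdn : ∀ x, ∃ y, r y x)
    (hd : ∀ x y, r x y → ∃ z, r x z ∧ r z y)
    (hP : ∀ a b c, r a b → Inc r c a → ¬ Inc r c b) :
    (∃ n : ℕ, 1 ≤ n ∧ RelIsoRel r (COrd (Fin n))) ∨ RelIsoRel r (COrd ℕ) := by
  let s : Setoid X := ⟨fun a b => ¬ r a b ∧ ¬ r b a, ⟨fun a => by simp [hirr],
    fun {a b} h => h.symm, fun {a b c} h1 h2 => by
      have k1 := hP a c b
      have k2 := hP c a b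
      grind [Inc]⟩⟩
  have hs : ∀ a b : X, (Quotient.mk s a = Quotient.mk s b) ↔ (¬ r a b ∧ ¬ r b a) :=
    fun a b => by rw [Quotient.eq]; rfl
  have hl : ∀ a b b', r a b → (¬ r b b' ∧ ¬ r b' b) → r a b' := by
    intro a b b' h h'
    have k1 := hP a b b'
    grind [Inc]
  have hl' : ∀ a b a', r a b → (¬ r a a' ∧ ¬ r a' a) → r a' b := by
    intro a b a' h h'
    have k1 := hP a b a'
    grind [Inc]
  let R : Quotient s → Quotient s → Prop := Quotient.lift₂ r (by
    intro a b a' b' (h1 : ¬ r a a' ∧ ¬ r a' a) (h2 : ¬ r b b' ∧ ¬ r b' b)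
    refine propext ⟨fun h => hl' _ _ _ (hl _ _ _ h h2) h1,
      fun h => hl' _ _ _ (hl _ _ _ h h2.symm) h1.symm⟩)
  have hR : ∀ a b, R (Quotient.mk s a) (Quotient.mk s b) ↔ r a b := fun a b => Iff.rfl
  obtain ⟨e, he⟩ : ∃ e : Quotient s ≃ ℚ, ∀ x y, R x y ↔ e x < e y := by
    have hne : Nonempty (Quotient s) := ⟨Quotient.mk s (Classical.arbitrary X)⟩
    apply iso_rat R
    · rintro ⟨x⟩; exact hirr x
    · rintro ⟨x⟩ ⟨y⟩ ⟨z⟩; exact htr x y z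
    · rintro ⟨x⟩ ⟨y⟩
      by_cases h1 : r x y
      · exact Or.inl h1
      by_cases h2 : r y x
      · exact Or.inr (Or.inr h2)
      exact Or.inr (Or.inl ((hs x y).2 ⟨h1, h2⟩))
    · rintro ⟨x⟩
      obtain ⟨y, hy⟩ := hup x
      exact ⟨Quotient.mk s y, hy⟩
    · rintro ⟨x⟩
      obtain ⟨y, hy⟩ := hdn x
      exact ⟨Quotient.mk s y, hy⟩
    · rintro ⟨x⟩ ⟨y⟩ h
      obtain ⟨z, hz⟩ := hd x y h
      exact ⟨Quotient.mk s z, hz⟩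
  let x0 : X := Classical.arbitrary X
  let F := {x : X // Quotient.mk s x = Quotient.mk s x0}
  haveI : Nonempty F := ⟨⟨x0, rfl⟩⟩
  have hfib : ∀ q : Quotient s, Nonempty ({x : X // Quotient.mk s x = q} ≃ F) := by
    intro q
    obtain ⟨x, rfl⟩ := Quotient.exists_rep q
    obtain ⟨g, hg, hgx⟩ := hom1 hirr hu x x0
    refine ⟨g.subtypeEquiv fun a => ?_⟩
    rw [hs, hs, hg a x, hg x a, hgx]
  have main : ∀ I : Type, Nonempty (F ≃ I) → RelIsoRel r (COrd I) := by
    rintro I ⟨k⟩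
    have hf2 : ∀ q : Quotient s, Nonempty ({x : X // Quotient.mk s x = q} ≃ I) :=
      fun q => ⟨(hfib q).some.trans k⟩
    let φ : ∀ q : Quotient s, {x : X // Quotient.mk s x = q} ≃ I := fun q => (hf2 q).some
    clear_value φ
    refine ⟨⟨fun x => (e (Quotient.mk s x), φ _ ⟨x, rfl⟩),
      fun y => ((φ (e.symm y.1)).symm y.2).1, fun x => ?_, fun y => ?_⟩, fun x y => ?_⟩
    · have : ∀ q (h : Quotient.mk s x = q), ((φ q).symm (φ _ ⟨x, rfl⟩)).1 = x := by
        rintro _ rfl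
        simp
      exact this _ (by simp)
    · have key : ∀ q' (z : {x : X // Quotient.mk s x = q'}),
          ((e (Quotient.mk s z.1), φ _ ⟨z.1, rfl⟩) : ℚ × I) = (e q', φ q' z) := by
        rintro _ ⟨z, rfl⟩; rfl
      exact (key _ ((φ (e.symm y.1)).symm y.2)).trans (by simp)
    · exact he (Quotient.mk s x) (Quotient.mk s y)
  rcases countable_cases F with ⟨n, hn, k⟩ | k
  · exact Or.inl ⟨n, hn, main _ k⟩
  · exact Or.inr (main _ k)

lemma relIso_nat_random {X : Type*} [Countable X] [Infinite X] {r : X → X → Prop}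
    (h : IsRandomPosetRel r) : ∃ (D : Type) (s : D → D → Prop), Countable D ∧ Infinite D ∧
         IsRandomPosetRel s ∧ RelIsoRel r s := by
  classical
  obtain ⟨e⟩ := nonempty_equiv_of_countable (α := X) (β := ℕ)
  obtain ⟨h1, h2, h3⟩ := h
  refine ⟨ℕ, fun a b => r (e.symm a) (e.symm b), inferInstance, inferInstance,
    ⟨fun x => h1 _, fun x y z => h2 _ _ _, ?_⟩, e, fun x y => by simp⟩
  intro L G U d1 d2 d3 c1 c2 c3
  have hi : Function.Injective e.symm := e.symm.injective
  obtain ⟨p, k1, k2, k3, k4, k5, k6⟩ := h3 (L.image e.symm) (G.image e.symm) (U.image e.symm)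
    ((Finset.disjoint_image hi).2 d1) ((Finset.disjoint_image hi).2 d2)
    ((Finset.disjoint_image hi).2 d3) (by simpa using c1) (by simpa using c2) (by simpa using c3)
  simp only [Finset.mem_image, forall_exists_index, and_imp, forall_apply_eq_imp_iff₂]
    at k1 k2 k3 k4 k5 k6
  refine ⟨e p, fun h => k1 ⟨_, h, by simp⟩, fun h => k2 ⟨_, h, by simp⟩, fun h => k3 ⟨_, h, by simp⟩,
    by simpa using k4, by simpa using k5, fun u hu => ?_⟩
  have := k6 u hu
  refine ⟨fun h => this.1 (by simp [← h]), by simpa using this.2⟩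

theorem statement_3 {X : Type*} [Countable X] [Infinite X] (r : X → X → Prop)
    (hirr : ∀ x, ¬ r x x) (htrans : ∀ x y z, r x y → r y z → r x z) :
    UltrahomogeneousRel r ↔
      (RelIsoRel r (fun (_ _ : ℕ) => False) ∨
       (∃ n : ℕ, 1 ≤ n ∧ RelIsoRel r (BOrd (Fin n))) ∨
       RelIsoRel r (BOrd ℕ) ∨
       (∃ n : ℕ, 1 ≤ n ∧ RelIsoRel r (COrd (Fin n))) ∨
       RelIsoRel r (COrd ℕ) ∨
       (∃ (D : Type) (s : D → D → Prop), Countable D ∧ Infinite D ∧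
         IsRandomPosetRel s ∧ RelIsoRel r s)) := by

  constructor
  · intro hu
    by_cases h0 : ∃ x y, r x y
    swap
    · left
      obtain ⟨e⟩ := nonempty_equiv_of_countable (α := X) (β := ℕ)
      exact ⟨e, fun x y => iff_of_false (fun h => h0 ⟨x, y, h⟩) id⟩
    obtain ⟨x0, y0, h0⟩ := h0
    obtain ⟨hup, hdn, hd⟩ := basic_lt hirr htrans hu h0
    by_cases hP : ∃ a b c, r a b ∧ Inc r c a ∧ Inc r c b
    swap
    · have := case_C hirr htrans hu hup hdn hd
        (fun a b c h1 h2 h3 => hP ⟨a, b, c, h1, h2, h3⟩)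
      rcases this with h | h
      · exact Or.inr (Or.inr (Or.inr (Or.inl h)))
      · exact Or.inr (Or.inr (Or.inr (Or.inr (Or.inl h))))
    have hfin : (∃ a b c, r a b ∧ r a c ∧ Inc r b c) → (∃ a b c, r b a ∧ r c a ∧ Inc r b c) →
        IsRandomPosetRel r := random_of hirr htrans hu hP
    by_cases hV : ∃ a b c, r a b ∧ r a c ∧ Inc r b c
    · have := relIso_nat_random (hfin hV (Lam_of_V hirr htrans hu hP hV))
      exact Or.inr (Or.inr (Or.inr (Or.inr (Or.inr this))))
    by_cases hL : ∃ a b c, r b a ∧ r c a ∧ Inc r b c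
    · exfalso
      apply hV
      obtain ⟨a, b, c, h1, h2, h3⟩ := Lam_of_V (r := fun a b => r b a) hirr
        (fun x y z h1 h2 => htrans _ _ _ h2 h1) (ultra_flip hu) (by
          obtain ⟨a, b, c, h1, h2, h3⟩ := hP
          exact ⟨b, a, c, h1, inc_flip.2 h3, inc_flip.2 h2⟩) (by
          obtain ⟨a, b, c, h1, h2, h3⟩ := hL
          exact ⟨a, b, c, h1, h2, inc_flip.2 h3⟩)
      exact ⟨a, b, c, h1, h2, inc_flip.1 h3⟩
    have := case_B hirr htrans hup hdn hd
      (fun a b c h1 h2 h3 => hV ⟨a, b, c, h1, h2, h3⟩)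
      (fun a b c h1 h2 h3 => hL ⟨a, b, c, h1, h2, h3⟩)
    rcases this with h | h
    · exact Or.inr (Or.inl h)
    · exact Or.inr (Or.inr (Or.inl h))
  · rintro (h | ⟨n, -, h⟩ | h | ⟨n, -, h⟩ | h | ⟨D, s, hc, -, hs, h⟩)
    · exact ultra_transfer h ultra_empty
    · exact ultra_transfer h (ultra_B _)
    · exact ultra_transfer h (ultra_B _)
    · exact ultra_transfer h (ultra_C _)
    · exact ultra_transfer h (ultra_C _)
    · exact ultra_transfer h (ultra_random s hs)
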